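/- arXiv:1412.8192 — 2 statements merged into one kernel-verified Lean document; each statement's English description precedes it below -/
import Mathlib

section
/- Let n ≥ 1, let X and Y be n×n positive definite Hermitian matrices with X − Y positive semidefinite, and let α be an integer with 1 ≤ α ≤ n. Then S_α(X^{−1}) ≤ S_α(Y^{−1}). -/
open scoped ComplexOrder

/-- `S n k lam` is the `k`-th elementary symmetric polynomial of `lam ∈ ℝⁿ`,
with the conventions `S n 0 lam = 1` and `S n k lam = 0` for `k > n`. -/
noncomputable def S (n k : ℕ) (lam : Fin n → ℝ) : ℝ :=
  ∑ A ∈ Finset.powersetCard k (Finset.univ : Finset (Fin n)), ∏ i ∈ A, lam i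

/-- `Si n k i lam` is `S_k` evaluated at `lam` with its `i`-th entry replaced by `0`. -/
noncomputable def Si (n k : ℕ) (i : Fin n) (lam : Fin n → ℝ) : ℝ :=
  S n k (Function.update lam i 0)

/-- `Sm α Y` is the `α`-th elementary symmetric polynomial of the eigenvalues of `Y`,
i.e. `(−1)^α` times the coefficient of `t^{n−α}` in the characteristic polynomial
`det (t·I − Y)` (for Hermitian `Y` this is real, so we take the real part). -/
noncomputable def Sm {n : ℕ} (α : ℕ) (Y : Matrix (Fin n) (Fin n) ℂ) : ℝ :=
  ((-1 : ℂ) ^ α * Y.charpoly.coeff (n - α)).re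

namespace Matrix

variable {𝕜 m : Type*} [RCLike 𝕜] [Fintype m] [DecidableEq m]

/-- If `P` is positive semidefinite, then `1 ≤ det (1 + P)`. -/
theorem PosSemidef.one_le_det_one_add {P : Matrix m m 𝕜} (hP : P.PosSemidef) :
    1 ≤ (1 + P).det := by
  have h := congrArg (Polynomial.eval (-1)) hP.isHermitian.charpoly_eq
  rw [eval_charpoly, Polynomial.eval_prod] at h
  have hdet : (1 + P).det = ∏ i, ((1 + hP.isHermitian.eigenvalues i : ℝ) : 𝕜) := by
    have hneg : 1 + P = -(scalar m (-1) - P) := by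
      rw [map_neg, map_one]
      abel
    rw [hneg, det_neg, h, Fintype.card, ← Finset.prod_const, ← Finset.prod_mul_distrib]
    refine Finset.prod_congr rfl fun i _ => ?_
    simp
    ring
  rw [hdet, ← RCLike.ofReal_prod]
  have : (1 : ℝ) ≤ ∏ i, (1 + hP.isHermitian.eigenvalues i) :=
    Finset.one_le_prod fun i _ => le_add_of_nonneg_right (hP.eigenvalues_nonneg i)
  exact_mod_cast this

open scoped MatrixOrder in
/-- The determinant is monotone for the Loewner order on positive definite matrices. -/
theorem PosDef.det_le_det {A B : Matrix m m 𝕜} (hA : A.PosDef) (hAB : (B - A).PosSemidef) :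
    A.det ≤ B.det := by
  obtain ⟨C, hC⟩ := CStarAlgebra.nonneg_iff_eq_star_mul_self.mp hAB.nonneg
  have hU : IsUnit A.det := hA.det_pos.ne'.isUnit
  have hB : B = A * (1 + A⁻¹ * (Cᴴ * C)) := by
    rw [mul_add, mul_one, mul_nonsing_inv_cancel_left _ _ hU, ← star_eq_conjTranspose, ← hC,
      add_sub_cancel]
  rw [hB, det_mul, ← Matrix.mul_assoc, det_one_add_mul_comm, ← Matrix.mul_assoc]
  exact le_mul_of_one_le_right hA.det_pos.le
    (hA.inv.posSemidef.mul_mul_conjTranspose_same C).one_le_det_one_add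

/-- Inversion is antitone for the Loewner order on positive definite matrices. -/
theorem PosDef.inv_sub_inv_posSemidef {A B : Matrix m m 𝕜} (hA : A.PosDef) (hB : B.PosDef)
    (hAB : (B - A).PosSemidef) : (A⁻¹ - B⁻¹).PosSemidef := by
  have := hA.inv.isUnit.invertible
  have := hB.isUnit.invertible
  have hblock : (fromBlocks B 1 1ᴴ A⁻¹).PosSemidef := by
    rw [PosDef.fromBlocks₂₂ B 1 hA.inv]
    simpa [nonsing_inv_nonsing_inv A hA.det_pos.ne'.isUnit] using hAB
  simpa using (PosDef.fromBlocks₁₁ 1 A⁻¹ hB).mp hblock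

end Matrix

/-- `Sm α M` is the sum of the principal minors of `M` of size `α`. -/
theorem Sm_eq_sum_minors {n α : ℕ} (hα : α ≤ n) (M : Matrix (Fin n) (Fin n) ℂ) :
    Sm α M = ∑ s ∈ (Finset.univ : Finset (Fin n)).powersetCard α,
      (M.submatrix (Subtype.val : s → Fin n) (Subtype.val : s → Fin n)).det.re := by
  have h := M.charpoly_coeff_eq_sum_minors α (by simpa using hα)
  rw [Fintype.card_fin] at h
  rw [Sm, h, ← mul_assoc, ← mul_pow, neg_one_mul, neg_neg, one_pow, one_mul, Complex.re_sum]

/-- If `X, Y` are positive definite Hermitian with `X − Y` positive semidefinite,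
then `S_α(X⁻¹) ≤ S_α(Y⁻¹)`. -/
theorem esymm_inv_antitone (n : ℕ) (hn : 1 ≤ n) (X Y : Matrix (Fin n) (Fin n) ℂ)
    (hX : X.PosDef) (hY : Y.PosDef) (hXY : (X - Y).PosSemidef)
    (α : ℕ) (hα1 : 1 ≤ α) (hα2 : α ≤ n) :
    Sm α X⁻¹ ≤ Sm α Y⁻¹ := by
  rw [Sm_eq_sum_minors hα2, Sm_eq_sum_minors hα2]
  refine Finset.sum_le_sum fun s _ => ?_
  refine (Complex.le_def.mp ?_).1
  refine (hX.inv.submatrix Subtype.val_injective).det_le_det ?_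
  exact (hY.inv_sub_inv_posSemidef hX hXY).submatrix _
end

section
/- Let n ≥ 1, let μ = (μ_1,…,μ_n) ∈ ℝ^n have all entries positive, let ε > 0, and let a = (a_1,…,a_n) ∈ ℝ^n satisfy a_i ≤ 1/μ_i − ε for every i. Then for every integer α with 1 ≤ α ≤ n, one has Σ_{i=1}^n S_{α−1;i}(μ) · μ_i^2 · a_i ≤ (1 − (ε/n) · S_1(μ)) · α · S_α(μ). -/
/-- Setting the `i`-th entry to zero keeps exactly the terms of `S n k μ` that avoid `i`. -/
theorem Si_eq_sum_filter_notMem (n k : ℕ) (i : Fin n) (μ : Fin n → ℝ) :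
    Si n k i μ = ∑ A ∈ Finset.powersetCard k (Finset.univ : Finset (Fin n)) with i ∉ A,
      ∏ j ∈ A, μ j := by
  rw [Si, S, Finset.sum_filter]
  refine Finset.sum_congr rfl fun A _ => ?_
  split_ifs with h
  · exact Finset.prod_eq_zero h (Function.update_self i 0 μ)
  · exact Finset.prod_congr rfl fun j hj =>
      Function.update_of_ne (ne_of_mem_of_not_mem hj h) _ _

theorem Si_mul_eq_sum_filter_mem (n k : ℕ) (i : Fin n) (μ : Fin n → ℝ) :
    Si n k i μ * μ i = ∑ A ∈ Finset.powersetCard (k + 1) (Finset.univ : Finset (Fin n)) with i ∈ A,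
      ∏ j ∈ A, μ j := by
  rw [Si_eq_sum_filter_notMem, Finset.sum_mul]
  refine Finset.sum_nbij' (insert i) (fun A => A.erase i) ?_ ?_ ?_ ?_ ?_
  · intro A hA
    simp only [Finset.mem_filter, Finset.mem_powersetCard_univ] at hA ⊢
    exact ⟨by rw [Finset.card_insert_of_notMem hA.2, hA.1], Finset.mem_insert_self i A⟩
  · intro A hA
    simp only [Finset.mem_filter, Finset.mem_powersetCard_univ] at hA ⊢
    exact ⟨by rw [Finset.card_erase_of_mem hA.2, hA.1, Nat.add_sub_cancel],
      Finset.notMem_erase i A⟩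
  · exact fun A hA => Finset.erase_insert (Finset.mem_filter.mp hA).2
  · exact fun A hA => Finset.insert_erase (Finset.mem_filter.mp hA).2
  · exact fun A hA => by rw [Finset.prod_insert (Finset.mem_filter.mp hA).2, mul_comm]

theorem Si_mul_add_Si_succ (n k : ℕ) (i : Fin n) (μ : Fin n → ℝ) :
    Si n k i μ * μ i + Si n (k + 1) i μ = S n (k + 1) μ := by
  rw [Si_mul_eq_sum_filter_mem, Si_eq_sum_filter_notMem, S, Finset.sum_filter_add_sum_filter_not]

theorem sum_Si_mul (n k : ℕ) (μ : Fin n → ℝ) :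
    ∑ i, Si n k i μ * μ i = (k + 1) * S n (k + 1) μ := by
  simp_rw [Si_mul_eq_sum_filter_mem, Finset.sum_filter]
  rw [Finset.sum_comm, S, Finset.mul_sum]
  refine Finset.sum_congr rfl fun A hA => ?_
  rw [← Finset.sum_filter, Finset.sum_const, Finset.filter_univ_mem,
    (Finset.mem_powersetCard.mp hA).2, nsmul_eq_mul, Nat.cast_add_one]

theorem S_one (n : ℕ) (μ : Fin n → ℝ) : S n 1 μ = ∑ i, μ i := by
  simp [S, Finset.powersetCard_one]

theorem S_nonneg (n k : ℕ) {x : Fin n → ℝ} (hx : ∀ i, 0 ≤ x i) : 0 ≤ S n k x :=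
  Finset.sum_nonneg fun _ _ => Finset.prod_nonneg fun i _ => hx i

theorem S_mono (n k : ℕ) {x y : Fin n → ℝ} (hx : ∀ i, 0 ≤ x i) (hxy : ∀ i, x i ≤ y i) :
    S n k x ≤ S n k y :=
  Finset.sum_le_sum fun _ _ => Finset.prod_le_prod (fun i _ => hx i) fun i _ => hxy i

theorem S_comp_perm (n k : ℕ) (e : Equiv.Perm (Fin n)) (x : Fin n → ℝ) :
    S n k (x ∘ e) = S n k x := by
  refine Finset.sum_equiv e.finsetCongr (fun A => ?_) fun A _ => ?_
  · simp
  · simp [Finset.prod_map]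

/-- Deleting a larger entry leaves a smaller elementary symmetric polynomial. -/
theorem Si_le_Si_of_le (n k : ℕ) {μ : Fin n → ℝ} (hμ : ∀ i, 0 ≤ μ i) {i j : Fin n}
    (hij : μ i ≤ μ j) : Si n k j μ ≤ Si n k i μ := by
  rw [Si, Si, ← S_comp_perm n k (Equiv.swap i j) (Function.update μ i 0)]
  refine S_mono n k (fun l => ?_) fun l => ?_
  · rcases eq_or_ne l j with rfl | h
    · simp
    · simp [h, hμ l]
  · rcases eq_or_ne l j with rfl | hj
    · simp
    · rcases eq_or_ne l i with rfl | hi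
      · simp [hj, hj.symm, hij]
      · simp [Equiv.swap_apply_of_ne_of_ne hi hj, hi, hj]

/-- The products `S_{k;i}(μ) μ_i` are ordered like the entries `μ_i`. -/
theorem monovary_Si_mul (n k : ℕ) {μ : Fin n → ℝ} (hμ : ∀ i, 0 ≤ μ i) :
    Monovary (fun i => Si n k i μ * μ i) μ := by
  intro i j hij
  have hi := Si_mul_add_Si_succ n k i μ
  have hj := Si_mul_add_Si_succ n k j μ
  have hle := Si_le_Si_of_le n (k + 1) hμ hij.le
  dsimp only
  linarith

/-- If a_i ≤ 1/μ_i − ε for all i, then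
Σ_i S_{α−1;i}(μ)·μ_i²·a_i ≤ (1 − (ε/n)·S_1(μ))·α·S_α(μ). -/
theorem sum_esymm_update_mul_le (n : ℕ) (hn : 1 ≤ n) (μ : Fin n → ℝ)
    (hμ : ∀ i, 0 < μ i) (ε : ℝ) (hε : 0 < ε) (a : Fin n → ℝ)
    (ha : ∀ i, a i ≤ 1 / μ i - ε) (α : ℕ) (hα1 : 1 ≤ α) (hα2 : α ≤ n) :
    ∑ i, Si n (α - 1) i μ * (μ i) ^ 2 * a i
      ≤ (1 - (ε / n) * S n 1 μ) * α * S n α μ := by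
  obtain ⟨k, rfl⟩ : ∃ k, α = k + 1 := ⟨α - 1, by omega⟩
  have hn0 : (0 : ℝ) < n := by exact_mod_cast hn
  have hsum := sum_Si_mul n k μ
  have hcheb := (monovary_Si_mul n k fun i => (hμ i).le).sum_mul_sum_le_card_mul_sum
  rw [hsum, ← S_one, Fintype.card_fin] at hcheb
  have hterm (i : Fin n) : Si n k i μ * μ i ^ 2 * a i
      ≤ Si n k i μ * μ i - ε * (Si n k i μ * μ i * μ i) := by
    have hSi : 0 ≤ Si n k i μ := S_nonneg n k fun j => by
      rcases eq_or_ne j i with rfl | h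
      · simp
      · simp [h, (hμ j).le]
    calc Si n k i μ * μ i ^ 2 * a i
        ≤ Si n k i μ * μ i ^ 2 * (1 / μ i - ε) :=
          mul_le_mul_of_nonneg_left (ha i) (by positivity)
      _ = _ := by
          have := (hμ i).ne'
          field_simp
  rw [Nat.add_sub_cancel]
  refine (Finset.sum_le_sum fun i _ => hterm i).trans ?_
  rw [Finset.sum_sub_distrib, ← Finset.mul_sum, hsum]
  have hquad : (k + 1) * S n (k + 1) μ * S n 1 μ / n ≤ ∑ i, Si n k i μ * μ i * μ i :=
    (div_le_iff₀' hn0).mpr hcheb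
  calc (k + 1) * S n (k + 1) μ - ε * ∑ i, Si n k i μ * μ i * μ i
      ≤ (k + 1) * S n (k + 1) μ - ε * ((k + 1) * S n (k + 1) μ * S n 1 μ / n) :=
        sub_le_sub_left (mul_le_mul_of_nonneg_left hquad hε.le) _
    _ = _ := by
        push_cast
        ring
end
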